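/- Let η(R, x̄) be a first-order formula in which the relation symbol R occurs only positively, with ar(R) = |x̄| = n and free variables among x̄, and let z̄ be an n-tuple of variables not occurring in η. Then there exists an Inclusion Logic formula η̃(z̄) such that for all structures M and all teams X over M whose domain contains the variables of z̄: M ⊨_X η̃(z̄) if and only if M ⊨_s [gfp_{R,x̄} η(R,x̄)] z̄ for every s ∈ X. -/

import Mathlib

open FirstOrder Language Set

namespace TeamSem

/-- The set of variables occurring in a term. -/
def tvars {L : Language} : L.Term ℕ → Set ℕ
  | Term.var v => {v}
  | Term.func _ ts => ⋃ i, tvars (ts i)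

/-- Formulas of Inclusion Logic FO(⊆) in negation normal form, over the signature `L`,
with variables from `ℕ`. -/
inductive IncForm (L : Language) where
  | rel {n : ℕ} (R : L.Relations n) (ts : Fin n → L.Term ℕ)
  | nrel {n : ℕ} (R : L.Relations n) (ts : Fin n → L.Term ℕ)
  | eq (t u : L.Term ℕ)
  | neq (t u : L.Term ℕ)
  | incl {k : ℕ} (ts us : Fin k → L.Term ℕ)
  | and (φ ψ : IncForm L)
  | or (φ ψ : IncForm L)
  | ex (v : ℕ) (φ : IncForm L)
  | all (v : ℕ) (φ : IncForm L)

variable {L : Language}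

/-- The supplemented team `X[H/v]`. -/
def suppTeam {M : Type*} (X : Set (ℕ → M)) (H : (ℕ → M) → Set M) (v : ℕ) : Set (ℕ → M) :=
  {t | ∃ s ∈ X, ∃ m ∈ H s, t = Function.update s v m}

/-- The duplicated team `X[M/v]`. -/
def dupTeam (M : Type*) (X : Set (ℕ → M)) (v : ℕ) : Set (ℕ → M) :=
  {t | ∃ s ∈ X, ∃ m : M, t = Function.update s v m}

/-- Lax team semantics for Inclusion Logic: `teamSat M φ X` says `M ⊨_X φ`. -/
def teamSat (M : Type*) [L.Structure M] : IncForm L → Set (ℕ → M) → Prop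
  | .rel R ts, X => ∀ s ∈ X, Structure.RelMap R fun i => (ts i).realize s
  | .nrel R ts, X => ∀ s ∈ X, ¬ Structure.RelMap R fun i => (ts i).realize s
  | .eq t u, X => ∀ s ∈ X, t.realize s = u.realize s
  | .neq t u, X => ∀ s ∈ X, t.realize s ≠ u.realize s
  | .incl ts us, X => ∀ s ∈ X, ∃ s' ∈ X, ∀ i, (ts i).realize s = (us i).realize s'
  | .and φ ψ, X => teamSat M φ X ∧ teamSat M ψ X
  | .or φ ψ, X => ∃ Y Z, X = Y ∪ Z ∧ teamSat M φ Y ∧ teamSat M ψ Z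
  | .ex v φ, X => ∃ H : (ℕ → M) → Set M, (∀ s ∈ X, (H s).Nonempty) ∧
      teamSat M φ (suppTeam X H v)
  | .all v φ, X => teamSat M φ (dupTeam M X v)

/-- Free variables of an Inclusion Logic formula. -/
def fvInc : IncForm L → Set ℕ
  | .rel _ ts => ⋃ i, tvars (ts i)
  | .nrel _ ts => ⋃ i, tvars (ts i)
  | .eq t u => tvars t ∪ tvars u
  | .neq t u => tvars t ∪ tvars u
  | .incl ts us => (⋃ i, tvars (ts i)) ∪ ⋃ i, tvars (us i)
  | .and φ ψ => fvInc φ ∪ fvInc ψ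
  | .or φ ψ => fvInc φ ∪ fvInc ψ
  | .ex v φ => fvInc φ \ {v}
  | .all v φ => fvInc φ \ {v}

/-- Truth of an FO(⊆) sentence in a model: satisfaction by the team consisting of the
empty assignment (encoded, with total assignments, as the singleton team `{s}` for
every `s`; for sentences all these coincide). -/
def incTrue (M : Type*) [L.Structure M] (φ : IncForm L) : Prop :=
  ∀ s : ℕ → M, teamSat M φ {s}

/-- The relation `X(x̄)` of values of a team, for `x̄ = (x_0, …, x_{n-1})` where we use
the variables `0, …, n-1` for `x₁, …, xₙ`. -/
def teamRel (n : ℕ) {M : Type*} (X : Set (ℕ → M)) : Set (Fin n → M) :=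
  {a | ∃ s ∈ X, a = fun j : Fin n => s (j : ℕ)}

end TeamSem

namespace TeamSem

/-- Interpretations of second-order relation variables: relation variable number `i`
of arity `k` is interpreted as `I k i`. -/
def RelInterp (M : Type*) : Type _ := (k : ℕ) → ℕ → Set (Fin k → M)

/-- The trivial interpretation (all relation variables empty). -/
def botI (M : Type*) : RelInterp M := fun _ _ => ∅

/-- Update the interpretation of relation variable `i` of arity `n` to `Q`. -/
def updI {M : Type*} (I : RelInterp M) (n i : ℕ) (Q : Set (Fin n → M)) : RelInterp M :=
  fun k j => {a | if h : k = n ∧ j = i then (fun m => a (Fin.cast h.1.symm m)) ∈ Q else a ∈ I k j}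

/-- Simultaneous update of an assignment on the variables `xs` by the tuple `a`. -/
noncomputable def updVec {M : Type*} (s : ℕ → M) {n : ℕ} (xs : Fin n → ℕ)
    (a : Fin n → M) : ℕ → M :=
  fun v => if h : ∃ j, xs j = v then a h.choose else s v

/-- Formulas of Positive Greatest Fixed Point Logic (PGFP) in negation normal form:
second-order relation variables (`rvar i`, of arity `n`) and the `gfp` operator can occur
only positively (there are no negated `rvar`/`gfp` constructors). -/
inductive GFPForm (L : Language) where
  | rel {n : ℕ} (R : L.Relations n) (ts : Fin n → L.Term ℕ)
  | nrel {n : ℕ} (R : L.Relations n) (ts : Fin n → L.Term ℕ)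
  | eq (t u : L.Term ℕ)
  | neq (t u : L.Term ℕ)
  | rvar (i : ℕ) {n : ℕ} (ts : Fin n → L.Term ℕ)
  | and (φ ψ : GFPForm L)
  | or (φ ψ : GFPForm L)
  | ex (v : ℕ) (φ : GFPForm L)
  | all (v : ℕ) (φ : GFPForm L)
  | gfp (i n : ℕ) (xs : Fin n → ℕ) (φ : GFPForm L) (ts : Fin n → L.Term ℕ)

variable {L : Language}

/-- Tarski semantics for PGFP.  The clause for `gfp i n xs φ ts` uses the Knaster–Tarski
characterization: the greatest fixed point of the monotone operator
`Γ(Q) = {ā | (M, Q/i) ⊨ φ(ā)}` equals `⋃ {Q | Q ⊆ Γ(Q)}`. -/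
def gsat (M : Type*) [L.Structure M] : GFPForm L → RelInterp M → (ℕ → M) → Prop
  | .rel R ts, _, s => Structure.RelMap R fun i => (ts i).realize s
  | .nrel R ts, _, s => ¬ Structure.RelMap R fun i => (ts i).realize s
  | .eq t u, _, s => t.realize s = u.realize s
  | .neq t u, _, s => t.realize s ≠ u.realize s
  | .rvar i ts, I, s => (fun j => (ts j).realize s) ∈ I _ i
  | .and φ ψ, I, s => gsat M φ I s ∧ gsat M ψ I s
  | .or φ ψ, I, s => gsat M φ I s ∨ gsat M ψ I s
  | .ex v φ, I, s => ∃ m : M, gsat M φ I (Function.update s v m)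
  | .all v φ, I, s => ∀ m : M, gsat M φ I (Function.update s v m)
  | .gfp i n xs φ ts, I, s =>
      (fun j => (ts j).realize s) ∈
        ⋃₀ {Q : Set (Fin n → M) | Q ⊆ {a | gsat M φ (updI I n i Q) (updVec s xs a)}}

/-- Free first-order variables of a PGFP formula. -/
def fvG : GFPForm L → Set ℕ
  | .rel _ ts => ⋃ i, tvars (ts i)
  | .nrel _ ts => ⋃ i, tvars (ts i)
  | .eq t u => tvars t ∪ tvars u
  | .neq t u => tvars t ∪ tvars u
  | .rvar _ ts => ⋃ i, tvars (ts i)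
  | .and φ ψ => fvG φ ∪ fvG ψ
  | .or φ ψ => fvG φ ∪ fvG ψ
  | .ex v φ => fvG φ \ {v}
  | .all v φ => fvG φ \ {v}
  | .gfp _ _ xs φ ts => (⋃ i, tvars (ts i)) ∪ (fvG φ \ Set.range fun j => xs j)

/-- All first-order variables (free or bound) occurring in a PGFP formula. -/
def avG : GFPForm L → Set ℕ
  | .rel _ ts => ⋃ i, tvars (ts i)
  | .nrel _ ts => ⋃ i, tvars (ts i)
  | .eq t u => tvars t ∪ tvars u
  | .neq t u => tvars t ∪ tvars u
  | .rvar _ ts => ⋃ i, tvars (ts i)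
  | .and φ ψ => avG φ ∪ avG ψ
  | .or φ ψ => avG φ ∪ avG ψ
  | .ex v φ => {v} ∪ avG φ
  | .all v φ => {v} ∪ avG φ
  | .gfp _ _ xs φ ts => (⋃ i, tvars (ts i)) ∪ (Set.range fun j => xs j) ∪ avG φ

/-- Free relation variables of a PGFP formula, together with their arities. -/
def rvG : GFPForm L → Set (ℕ × ℕ)
  | @GFPForm.rvar _ i n _ => {(i, n)}
  | .and φ ψ => rvG φ ∪ rvG ψ
  | .or φ ψ => rvG φ ∪ rvG ψ
  | .ex _ φ => rvG φ
  | .all _ φ => rvG φ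
  | .gfp i n _ φ _ => rvG φ \ {(i, n)}
  | _ => ∅

/-- PGFP formulas containing no `gfp` operator, i.e. first-order formulas
(possibly mentioning relation variables positively). -/
def NoGfp : GFPForm L → Prop
  | .and φ ψ => NoGfp φ ∧ NoGfp ψ
  | .or φ ψ => NoGfp φ ∧ NoGfp ψ
  | .ex _ φ => NoGfp φ
  | .all _ φ => NoGfp φ
  | .gfp .. => False
  | _ => True

end TeamSem

namespace TeamSem

section Locality

variable {L : Language} {M : Type*} [L.Structure M]

theorem realize_congr_of_eqOn {s t : ℕ → M} (u : L.Term ℕ) (h : EqOn s t (tvars u)) :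
    u.realize s = u.realize t := by
  induction u with
  | var v => exact h (by simp [tvars])
  | func f ts ih =>
    simp only [Term.realize]
    congr 1
    funext i
    exact ih i (h.mono (by simp only [tvars]; exact subset_iUnion (fun i => tvars (ts i)) i))

theorem realize_tuple_congr_of_eqOn {s t : ℕ → M} {m : ℕ} {ts : Fin m → L.Term ℕ}
    (h : EqOn s t (⋃ i, tvars (ts i))) :
    (fun i => (ts i).realize s) = fun i => (ts i).realize t :=
  funext fun i => realize_congr_of_eqOn _ (h.mono (subset_iUnion (fun i => tvars (ts i)) i))

theorem eqOn_update_of_diff {s t : ℕ → M} {v : ℕ} {A : Set ℕ} (h : EqOn s t (A \ {v})) (m : M) :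
    EqOn (Function.update s v m) (Function.update t v m) A := by
  intro x hx
  by_cases hxv : x = v
  · subst hxv; simp
  · simpa [hxv] using h ⟨hx, hxv⟩

theorem gsat_congr_of_eqOn (φ : GFPForm L) (hφ : NoGfp φ) (I : RelInterp M) {s t : ℕ → M}
    (h : EqOn s t (fvG φ)) : gsat M φ I s ↔ gsat M φ I t := by
  induction φ generalizing s t with
  | rel R ts => simp only [gsat, realize_tuple_congr_of_eqOn h]
  | nrel R ts => simp only [gsat, realize_tuple_congr_of_eqOn h]
  | rvar i ts => simp only [gsat, realize_tuple_congr_of_eqOn h]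
  | eq u w =>
    simp only [gsat, realize_congr_of_eqOn u (h.mono subset_union_left),
      realize_congr_of_eqOn w (h.mono subset_union_right)]
  | neq u w =>
    simp only [gsat, realize_congr_of_eqOn u (h.mono subset_union_left),
      realize_congr_of_eqOn w (h.mono subset_union_right)]
  | and φ ψ ih₁ ih₂ =>
    exact and_congr (ih₁ hφ.1 (h.mono subset_union_left)) (ih₂ hφ.2 (h.mono subset_union_right))
  | or φ ψ ih₁ ih₂ =>
    exact or_congr (ih₁ hφ.1 (h.mono subset_union_left)) (ih₂ hφ.2 (h.mono subset_union_right))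
  | ex v φ ih => exact exists_congr fun m => ih hφ (eqOn_update_of_diff h m)
  | all v φ ih => exact forall_congr' fun m => ih hφ (eqOn_update_of_diff h m)
  | gfp => exact hφ.elim

theorem fvG_subset_avG (φ : GFPForm L) : fvG φ ⊆ avG φ := by
  induction φ with
  | and φ ψ ih₁ ih₂ => exact union_subset_union ih₁ ih₂
  | or φ ψ ih₁ ih₂ => exact union_subset_union ih₁ ih₂
  | ex v φ ih => exact sdiff_subset.trans (ih.trans subset_union_right)
  | all v φ ih => exact sdiff_subset.trans (ih.trans subset_union_right)
  | gfp i n xs φ ts ih =>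
    exact union_subset_union subset_union_left (sdiff_subset.trans ih)
  | _ => exact Subset.rfl

theorem finite_tvars (u : L.Term ℕ) : (tvars u).Finite := by
  induction u with
  | var v => exact finite_singleton v
  | func f ts ih => exact finite_iUnion ih

theorem finite_avG (φ : GFPForm L) : (avG φ).Finite := by
  induction φ with
  | rel R ts => exact finite_iUnion fun i => finite_tvars _
  | nrel R ts => exact finite_iUnion fun i => finite_tvars _
  | rvar i ts => exact finite_iUnion fun i => finite_tvars _
  | eq u w => exact (finite_tvars u).union (finite_tvars w)
  | neq u w => exact (finite_tvars u).union (finite_tvars w)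
  | and φ ψ ih₁ ih₂ => exact ih₁.union ih₂
  | or φ ψ ih₁ ih₂ => exact ih₁.union ih₂
  | ex v φ ih => exact (finite_singleton v).union ih
  | all v φ ih => exact (finite_singleton v).union ih
  | gfp i n xs φ ts ih =>
    exact ((finite_iUnion fun i => finite_tvars _).union (finite_range _)).union ih

end Locality

section Teams

variable {L : Language} {M : Type*}

/-- Two teams agree up to the values of the variables in `V`. -/
def TeamEqv (V : Set ℕ) (X Y : Set (ℕ → M)) : Prop :=
  (∀ s ∈ X, ∃ t ∈ Y, EqOn s t Vᶜ) ∧ ∀ t ∈ Y, ∃ s ∈ X, EqOn s t Vᶜ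

theorem eq_update_of_eqOn_compl {s t : ℕ → M} {v : ℕ} (h : EqOn s t {v}ᶜ) :
    t = Function.update s v (t v) := by
  funext x
  by_cases hx : x = v
  · subst hx; simp
  · simpa [hx] using (h (show x ∈ ({v} : Set ℕ)ᶜ from hx)).symm

theorem eqOn_update_compl (s : ℕ → M) (v : ℕ) (m : M) :
    EqOn s (Function.update s v m) {v}ᶜ := by
  intro x hx
  have hx : x ≠ v := hx
  simp [hx]

theorem teamEqv_dupTeam (X : Set (ℕ → M)) (v : ℕ) : TeamEqv {v} X (dupTeam M X v) := by
  refine ⟨fun s hs => ⟨s, ⟨s, hs, s v, by simp⟩, fun _ _ => rfl⟩, ?_⟩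
  rintro _ ⟨s, hs, m, rfl⟩
  exact ⟨s, hs, eqOn_update_compl s v m⟩

variable [L.Structure M]

theorem teamSat_ex_iff (φ : IncForm L) (v : ℕ) (X : Set (ℕ → M)) :
    teamSat M (.ex v φ) X ↔ ∃ Y, TeamEqv {v} X Y ∧ teamSat M φ Y := by
  constructor
  · rintro ⟨H, hH, hφ⟩
    refine ⟨_, ⟨fun s hs => ?_, ?_⟩, hφ⟩
    · obtain ⟨m, hm⟩ := hH s hs
      exact ⟨_, ⟨s, hs, m, hm, rfl⟩, eqOn_update_compl s v m⟩
    · rintro _ ⟨s, hs, m, -, rfl⟩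
      exact ⟨s, hs, eqOn_update_compl s v m⟩
  · rintro ⟨Y, ⟨h₁, h₂⟩, hφ⟩
    refine ⟨fun s => {m | Function.update s v m ∈ Y}, fun s hs => ?_, ?_⟩
    · obtain ⟨t, ht, hst⟩ := h₁ s hs
      exact ⟨t v, by rwa [mem_ofPred_eq, ← eq_update_of_eqOn_compl hst]⟩
    · convert hφ using 1
      ext t
      constructor
      · rintro ⟨s, -, m, hm, rfl⟩
        exact hm
      · intro ht
        obtain ⟨s, hs, hst⟩ := h₂ t ht
        refine ⟨s, hs, t v, ?_, eq_update_of_eqOn_compl hst⟩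
        rwa [mem_ofPred_eq, ← eq_update_of_eqOn_compl hst]

theorem teamSat_empty (φ : IncForm L) : teamSat M φ (∅ : Set (ℕ → M)) := by
  induction φ with
  | rel | nrel | eq | neq | incl => exact fun s hs => hs.elim
  | and φ ψ ih₁ ih₂ => exact ⟨ih₁, ih₂⟩
  | or φ ψ ih₁ ih₂ => exact ⟨∅, ∅, (union_empty ∅).symm, ih₁, ih₂⟩
  | ex v φ ih => exact (teamSat_ex_iff φ v ∅).2 ⟨∅, by simp [TeamEqv], ih⟩
  | all v φ ih =>
    have h : dupTeam M (∅ : Set (ℕ → M)) v = ∅ := by simp [dupTeam]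
    rwa [teamSat, h]

/-- Existential quantification over a list of variables. -/
def exs (l : List ℕ) (φ : IncForm L) : IncForm L := l.foldr IncForm.ex φ

theorem teamSat_exs_iff (l : List ℕ) (φ : IncForm L) (X : Set (ℕ → M)) :
    teamSat M (exs l φ) X ↔ ∃ Y, TeamEqv {v | v ∈ l} X Y ∧ teamSat M φ Y := by
  induction l generalizing X with
  | nil =>
    constructor
    · exact fun h => ⟨X, ⟨fun s hs => ⟨s, hs, fun _ _ => rfl⟩,
        fun s hs => ⟨s, hs, fun _ _ => rfl⟩⟩, h⟩
    · rintro ⟨Y, ⟨h₁, h₂⟩, h⟩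
      have key : ∀ s t : ℕ → M, EqOn s t {v | v ∈ ([] : List ℕ)}ᶜ → s = t :=
        fun s t hst => funext fun x => hst (by simp)
      have : X = Y := by
        ext s
        constructor
        · intro hs
          obtain ⟨t, ht, hst⟩ := h₁ s hs
          rwa [key s t hst]
        · intro hs
          obtain ⟨t, ht, hst⟩ := h₂ s hs
          rwa [← key t s hst]
      subst this
      exact h
  | cons v l ih =>
    change teamSat M (.ex v (exs l φ)) X ↔ _
    rw [teamSat_ex_iff]
    constructor
    · rintro ⟨Y, ⟨h₁, h₂⟩, h⟩
      obtain ⟨Z, ⟨h₃, h₄⟩, h⟩ := (ih Y).1 h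
      have key : ∀ s t r : ℕ → M, EqOn s t {v}ᶜ → EqOn t r {x | x ∈ l}ᶜ →
          EqOn s r {x | x ∈ v :: l}ᶜ := by
        intro s t r hst htr x hx
        simp only [List.mem_cons, mem_compl_iff, mem_ofPred_eq, not_or] at hx
        exact (hst hx.1).trans (htr hx.2)
      refine ⟨Z, ⟨fun s hs => ?_, fun r hr => ?_⟩, h⟩
      · obtain ⟨t, ht, hst⟩ := h₁ s hs
        obtain ⟨r, hr, htr⟩ := h₃ t ht
        exact ⟨r, hr, key s t r hst htr⟩
      · obtain ⟨t, ht, htr⟩ := h₄ r hr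
        obtain ⟨s, hs, hst⟩ := h₂ t ht
        exact ⟨s, hs, key s t r hst htr⟩
    · rintro ⟨Z, ⟨h₁, h₂⟩, h⟩
      have key : ∀ s t : ℕ → M, EqOn s t {x | x ∈ v :: l}ᶜ →
          EqOn (Function.update s v (t v)) t {x | x ∈ l}ᶜ := by
        intro s t hst x hx
        by_cases hxv : x = v
        · subst hxv; simp
        · simpa [hxv] using hst (show x ∈ {x | x ∈ v :: l}ᶜ by simpa [hxv] using hx)
      refine ⟨{r | ∃ s ∈ X, ∃ t ∈ Z, EqOn s t {x | x ∈ v :: l}ᶜ ∧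
        r = Function.update s v (t v)}, ⟨fun s hs => ?_, ?_⟩, (ih _).2 ⟨Z, ⟨?_, fun t ht => ?_⟩, h⟩⟩
      · obtain ⟨t, ht, hst⟩ := h₁ s hs
        exact ⟨_, ⟨s, hs, t, ht, hst, rfl⟩, eqOn_update_compl s v _⟩
      · rintro _ ⟨s, hs, t, ht, hst, rfl⟩
        exact ⟨s, hs, eqOn_update_compl s v _⟩
      · rintro _ ⟨s, hs, t, ht, hst, rfl⟩
        exact ⟨t, ht, key s t hst⟩
      · obtain ⟨s, hs, hst⟩ := h₂ t ht
        exact ⟨_, ⟨s, hs, t, ht, hst, rfl⟩, key s t hst⟩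

theorem teamSat_exs_of_forall_exists {l : List ℕ} {φ : IncForm L} {X : Set (ℕ → M)}
    (P : (ℕ → M) → Prop) (hP : ∀ s ∈ X, ∃ t, EqOn s t {v | v ∈ l}ᶜ ∧ P t)
    (hφ : ∀ Y, TeamEqv {v | v ∈ l} X Y →
      (∀ s ∈ X, ∀ t, EqOn s t {v | v ∈ l}ᶜ → P t → t ∈ Y) → (∀ t ∈ Y, P t) → teamSat M φ Y) :
    teamSat M (exs l φ) X := by
  have hY : TeamEqv {v | v ∈ l} X {t | (∃ s ∈ X, EqOn s t {v | v ∈ l}ᶜ) ∧ P t} := by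
    refine ⟨fun s hs => ?_, fun t ht => ht.1⟩
    obtain ⟨t, hst, ht⟩ := hP s hs
    exact ⟨t, ⟨⟨s, hs, hst⟩, ht⟩, hst⟩
  exact (teamSat_exs_iff l φ X).2
    ⟨_, hY, hφ _ hY (fun s hs t hst ht => ⟨⟨s, hs, hst⟩, ht⟩) fun t ht => ht.2⟩

theorem fvInc_exs (l : List ℕ) (φ : IncForm L) : fvInc (exs l φ) = fvInc φ \ {v | v ∈ l} := by
  induction l with
  | nil => simp [exs]
  | cons v l ih =>
    change fvInc (exs l φ) \ {v} = _
    rw [ih]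
    ext x
    simp only [mem_sdiff, mem_ofPred_eq, mem_singleton_iff, List.mem_cons]
    tauto

/-- A tautology without free variables. -/
def verum : IncForm L := .incl (k := 0) Fin.elim0 Fin.elim0

theorem teamSat_verum (X : Set (ℕ → M)) : teamSat M (verum : IncForm L) X :=
  fun s hs => ⟨s, hs, fun i => i.elim0⟩

theorem fvInc_verum : fvInc (verum : IncForm L) = ∅ := by simp [verum, fvInc]

/-- A contradiction without free variables. -/
def falsum : IncForm L := .ex 0 (.neq (Term.var 0) (Term.var 0))

theorem fvInc_falsum : fvInc (falsum : IncForm L) = ∅ := by simp [falsum, fvInc, tvars]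

/-- Conjunction of a list of formulas. -/
def listAnd (l : List (IncForm L)) : IncForm L := l.foldr IncForm.and verum

theorem teamSat_listAnd (l : List (IncForm L)) (X : Set (ℕ → M)) :
    teamSat M (listAnd l) X ↔ ∀ φ ∈ l, teamSat M φ X := by
  induction l with
  | nil => simpa [listAnd] using teamSat_verum X
  | cons φ l ih =>
    change teamSat M φ X ∧ teamSat M (listAnd l) X ↔ _
    simp [ih]

theorem fvInc_listAnd (l : List (IncForm L)) : fvInc (listAnd l) = ⋃ φ ∈ l, fvInc φ := by
  induction l with
  | nil => simpa [listAnd] using fvInc_verum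
  | cons φ l ih =>
    change fvInc φ ∪ fvInc (listAnd l) = _
    simp [ih]

/-- The team semantics of `φ` is given pointwise by the predicate `g`. -/
def Flat (M : Type*) [L.Structure M] (φ : IncForm L) (g : (ℕ → M) → Prop) : Prop :=
  ∀ X, teamSat M φ X ↔ ∀ s ∈ X, g s

theorem Flat.or {φ ψ : IncForm L} {g h : (ℕ → M) → Prop} (hφ : Flat M φ g) (hψ : Flat M ψ h) :
    Flat M (.or φ ψ) fun s => g s ∨ h s := by
  intro X
  constructor
  · rintro ⟨Y, Z, rfl, hY, hZ⟩ s (hs | hs)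
    · exact Or.inl ((hφ Y).1 hY s hs)
    · exact Or.inr ((hψ Z).1 hZ s hs)
  · intro hX
    refine ⟨{s ∈ X | g s}, {s ∈ X | h s}, ?_, (hφ _).2 fun s hs => hs.2,
      (hψ _).2 fun s hs => hs.2⟩
    ext s
    constructor
    · exact fun hs => (hX s hs).imp (fun h => ⟨hs, h⟩) fun h => ⟨hs, h⟩
    · rintro (hs | hs) <;> exact hs.1

theorem Flat.and {φ ψ : IncForm L} {g h : (ℕ → M) → Prop} (hφ : Flat M φ g) (hψ : Flat M ψ h) :
    Flat M (.and φ ψ) fun s => g s ∧ h s := by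
  intro X
  change teamSat M φ X ∧ teamSat M ψ X ↔ _
  rw [hφ X, hψ X]
  exact ⟨fun h s hs => ⟨h.1 s hs, h.2 s hs⟩,
    fun h => ⟨fun s hs => (h s hs).1, fun s hs => (h s hs).2⟩⟩

theorem Flat.all {φ : IncForm L} {g : (ℕ → M) → Prop} (hφ : Flat M φ g) (v : ℕ) :
    Flat M (.all v φ) fun s => ∀ m, g (Function.update s v m) := by
  intro X
  change teamSat M φ (dupTeam M X v) ↔ _
  rw [hφ]
  constructor
  · exact fun h s hs m => h _ ⟨s, hs, m, rfl⟩
  · rintro h _ ⟨s, hs, m, rfl⟩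
    exact h s hs m

theorem Flat.ex {φ : IncForm L} {g : (ℕ → M) → Prop} (hφ : Flat M φ g) (v : ℕ) :
    Flat M (.ex v φ) fun s => ∃ m, g (Function.update s v m) := by
  intro X
  constructor
  · rintro ⟨H, hH, h⟩ s hs
    obtain ⟨m, hm⟩ := hH s hs
    exact ⟨m, (hφ _).1 h _ ⟨s, hs, m, hm, rfl⟩⟩
  · intro h
    refine ⟨fun s => {m | g (Function.update s v m)}, h, (hφ _).2 ?_⟩
    rintro _ ⟨s, -, m, hm, rfl⟩
    exact hm

theorem flat_falsum : Flat M (falsum : IncForm L) fun _ => False := by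
  intro X
  have h : Flat M (.neq (Term.var 0) (Term.var 0) : IncForm L) fun s => s 0 ≠ s 0 := fun _ => Iff.rfl
  rw [falsum, h.ex 0 X]
  simp

end Teams

section FlatTranslation

variable {L : Language} {M : Type*} [L.Structure M]

/-- The translation of a first-order formula which makes all relation variables true. -/
def flatTr : GFPForm L → IncForm L
  | .rel R ts => .rel R ts
  | .nrel R ts => .nrel R ts
  | .eq t u => .eq t u
  | .neq t u => .neq t u
  | .rvar _ _ => verum
  | .and φ ψ => .and (flatTr φ) (flatTr ψ)
  | .or φ ψ => .or (flatTr φ) (flatTr ψ)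
  | .ex v φ => .ex v (flatTr φ)
  | .all v φ => .all v (flatTr φ)
  | .gfp .. => verum

theorem flat_flatTr (φ : GFPForm L) (hφ : NoGfp φ) (I : RelInterp M)
    (hI : ∀ p ∈ rvG φ, I p.2 p.1 = univ) : Flat M (flatTr φ) (gsat M φ I) := by
  induction φ with
  | rel | nrel | eq | neq => exact fun X => Iff.rfl
  | @rvar i m ts =>
    intro X
    have := hI (i, m) rfl
    simp only at this
    simp [flatTr, gsat, teamSat_verum, this]
  | and φ ψ ih₁ ih₂ =>
    exact (ih₁ hφ.1 fun p hp => hI p (Or.inl hp)).and (ih₂ hφ.2 fun p hp => hI p (Or.inr hp))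
  | or φ ψ ih₁ ih₂ =>
    exact (ih₁ hφ.1 fun p hp => hI p (Or.inl hp)).or (ih₂ hφ.2 fun p hp => hI p (Or.inr hp))
  | ex v φ ih => exact (ih hφ hI).ex v
  | all v φ ih => exact (ih hφ hI).all v
  | gfp => exact hφ.elim

theorem fvInc_flatTr (φ : GFPForm L) : fvInc (flatTr φ) ⊆ fvG φ := by
  induction φ with
  | rvar | gfp => simp [flatTr, fvInc_verum]
  | and φ ψ ih₁ ih₂ => exact union_subset_union ih₁ ih₂
  | or φ ψ ih₁ ih₂ => exact union_subset_union ih₁ ih₂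
  | ex v φ ih => exact sdiff_subset_sdiff_left ih
  | all v φ ih => exact sdiff_subset_sdiff_left ih
  | _ => exact Subset.rfl

end FlatTranslation

section GuardedTranslation

variable {L : Language} {M : Type*} [L.Structure M]

/-- The translation of a first-order formula `φ` for teams of assignments which either satisfy the
flat formula `G` or satisfy `φ`, where relation variables are interpreted by the values of the team
on the variables from `W` on. Fresh variables are taken from `k` on; a disjunction is translated by
recording the choice of the disjunct in fresh variables rather than by splitting the team. -/
def guardTr (W : ℕ) : GFPForm L → IncForm L → ℕ → IncForm L
  | .rel R ts, G, _ => .or G (.rel R ts)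
  | .nrel R ts, G, _ => .or G (.nrel R ts)
  | .eq t u, G, _ => .or G (.eq t u)
  | .neq t u, G, _ => .or G (.neq t u)
  | @GFPForm.rvar _ _ m ts, G, k =>
      exs (List.ofFn fun j : Fin m => k + (j : ℕ))
        (.and (.incl (fun j : Fin m => Term.var (k + (j : ℕ))) fun j => Term.var (W + (j : ℕ)))
          (listAnd (List.ofFn fun j : Fin m => .or G (.eq (Term.var (k + (j : ℕ))) (ts j)))))
  | .and φ ψ, G, k => .and (guardTr W φ G k) (guardTr W ψ G k)
  | .or φ ψ, G, k =>
      exs [k, k + 1]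
        (.and (guardTr W φ (.or G (.neq (Term.var k) (Term.var (k + 1)))) (k + 2))
          (guardTr W ψ (.or G (.eq (Term.var k) (Term.var (k + 1)))) (k + 2)))
  | .ex v φ, G, k => exs [v] (guardTr W φ G k)
  | .all v φ, G, k => .all v (guardTr W φ G k)
  | .gfp .., _, _ => verum

theorem fvInc_guardTr {n : ℕ} (W : ℕ) (φ : GFPForm L) (hrv : rvG φ ⊆ {(0, n)}) (G : IncForm L)
    (k : ℕ) : fvInc (guardTr W φ G k) ⊆ fvG φ ∪ fvInc G ∪ Ico W (W + n) := by
  induction φ generalizing G k with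
  | rel | nrel | eq | neq =>
    simp only [guardTr, fvInc, fvG]
    intro x
    simp only [mem_union]
    tauto
  | @rvar i m ts =>
    obtain ⟨rfl, rfl⟩ : i = 0 ∧ m = n := by simpa [rvG] using hrv
    rw [guardTr, fvInc_exs]
    rintro x ⟨hx, hx'⟩
    simp only [fvInc, fvInc_listAnd, tvars, mem_union, mem_iUnion, mem_singleton_iff,
      List.mem_ofFn, mem_ofPred_eq, not_exists, exists_prop] at hx hx' ⊢
    rcases hx with (⟨j, hj⟩ | ⟨j, hj⟩) | ⟨_, ⟨j, rfl⟩, hj⟩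
    · exact (hx' j hj.symm).elim
    · right; subst hj; simp
    · simp only [fvInc, tvars, mem_union, mem_singleton_iff] at hj
      rcases hj with hj | hj | hj
      · exact Or.inl (Or.inr hj)
      · exact (hx' j hj.symm).elim
      · exact Or.inl (Or.inl (by simpa [fvG] using ⟨j, hj⟩))
  | and φ ψ ih₁ ih₂ =>
    intro x hx
    have h₁ := @ih₁ (subset_union_left.trans hrv) G k x
    have h₂ := @ih₂ (subset_union_right.trans hrv) G k x
    simp only [guardTr, fvInc, fvG, mem_union] at *
    tauto
  | or φ ψ ih₁ ih₂ =>
    intro x hx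
    rw [guardTr, fvInc_exs] at hx
    have h₁ := @ih₁ (subset_union_left.trans hrv)
      (.or G (.neq (Term.var k) (Term.var (k + 1)))) (k + 2) x
    have h₂ := @ih₂ (subset_union_right.trans hrv)
      (.or G (.eq (Term.var k) (Term.var (k + 1)))) (k + 2) x
    simp only [fvInc, fvG, tvars, mem_union, mem_sdiff, mem_singleton_iff, mem_ofPred_eq,
      List.mem_cons, List.not_mem_nil] at *
    tauto
  | ex v φ ih =>
    intro x hx
    rw [guardTr, fvInc_exs] at hx
    have h₁ := @ih hrv G k x
    simp only [fvG, mem_union, mem_sdiff, mem_singleton_iff, mem_ofPred_eq,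
      List.mem_cons, List.not_mem_nil] at *
    tauto
  | all v φ ih =>
    intro x hx
    have h₁ := @ih hrv G k x
    simp only [guardTr, fvInc, fvG, mem_union, mem_sdiff, mem_singleton_iff] at *
    tauto
  | gfp => simp [guardTr, fvInc_verum]

theorem eqOn_of_compl_of_disjoint {s t : ℕ → M} {V A : Set ℕ} (h : EqOn s t Vᶜ)
    (hVA : ∀ v ∈ V, v ∉ A) : EqOn s t A :=
  h.mono fun _ hx hv => hVA _ hv hx

theorem flat_neq_var (u v : ℕ) :
    Flat M (.neq (Term.var u) (Term.var v) : IncForm L) fun s => s u ≠ s v := fun _ => Iff.rfl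

theorem flat_eq_var (u v : ℕ) :
    Flat M (.eq (Term.var u) (Term.var v) : IncForm L) fun s => s u = s v := fun _ => Iff.rfl

theorem or_congr_of_eqOn_Ico {g : (ℕ → M) → Prop} {a b : ℕ} (hab : a ≤ b)
    (hg : ∀ s t, EqOn s t (Ico a b) → (g s ↔ g t)) (r : M → M → Prop) (s t : ℕ → M)
    (h : EqOn s t (Ico a (b + 2))) : (g s ∨ r (s b) (s (b + 1))) ↔ (g t ∨ r (t b) (t (b + 1))) := by
  rw [hg s t (h.mono (Ico_subset_Ico_right (by omega))), h (show b ∈ _ from ⟨hab, by omega⟩),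
    h (show b + 1 ∈ _ from ⟨by omega, by omega⟩)]

theorem eqOn_tuple {s t : ℕ → M} {W n : ℕ} (h : EqOn s t (Ico W (W + n))) :
    (fun j : Fin n => s (W + (j : ℕ))) = fun j : Fin n => t (W + (j : ℕ)) :=
  funext fun j => h ⟨by omega, by omega⟩

theorem TeamEqv.forall_tuple_mem {V : Set ℕ} {X Y : Set (ℕ → M)} {W n : ℕ} {Q : Set (Fin n → M)}
    (hXY : TeamEqv V X Y) (hV : ∀ v ∈ V, v ∉ Ico W (W + n))
    (hX : ∀ s ∈ X, (fun j : Fin n => s (W + (j : ℕ))) ∈ Q) :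
    ∀ t ∈ Y, (fun j : Fin n => t (W + (j : ℕ))) ∈ Q := by
  intro t ht
  obtain ⟨s, hs, hst⟩ := hXY.2 t ht
  rw [← eqOn_tuple (eqOn_of_compl_of_disjoint hst hV)]
  exact hX s hs

theorem TeamEqv.forall_exists_tuple_eq {V : Set ℕ} {X Y : Set (ℕ → M)} {W n : ℕ}
    {Q : Set (Fin n → M)} (hXY : TeamEqv V X Y) (hV : ∀ v ∈ V, v ∉ Ico W (W + n))
    (hX : ∀ s ∈ X, ∀ a ∈ Q, ∃ s' ∈ X, (fun j : Fin n => s' (W + (j : ℕ))) = a) :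
    ∀ t ∈ Y, ∀ a ∈ Q, ∃ t' ∈ Y, (fun j : Fin n => t' (W + (j : ℕ))) = a := by
  intro t ht a ha
  obtain ⟨s, hs, -⟩ := hXY.2 t ht
  obtain ⟨s', hs', rfl⟩ := hX s hs a ha
  obtain ⟨t', ht', hst'⟩ := hXY.1 s' hs'
  exact ⟨t', ht', (eqOn_tuple (eqOn_of_compl_of_disjoint hst' hV)).symm⟩

theorem gsat_of_teamSat_guardTr {n W : ℕ} (I : RelInterp M) (φ : GFPForm L) (hφ : NoGfp φ)
    (hrv : rvG φ ⊆ {(0, n)}) (hav : ∀ v ∈ avG φ, v < W) (G : IncForm L) (k : ℕ) (hk : W + n ≤ k)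
    (g : (ℕ → M) → Prop) (hG : Flat M G g)
    (hg : ∀ s t, EqOn s t (Ico (W + n) k) → (g s ↔ g t)) (X : Set (ℕ → M))
    (hI : ∀ s ∈ X, (fun j : Fin n => s (W + (j : ℕ))) ∈ I n 0)
    (hX : teamSat M (guardTr W φ G k) X) : ∀ s ∈ X, g s ∨ gsat M φ I s := by
  induction φ generalizing G k g X with
  | rel R ts => exact (hG.or (h := gsat M (.rel R ts) I) (fun _ => Iff.rfl) X).1 hX
  | nrel R ts => exact (hG.or (h := gsat M (.nrel R ts) I) (fun _ => Iff.rfl) X).1 hX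
  | eq t u => exact (hG.or (h := gsat M (.eq t u) I) (fun _ => Iff.rfl) X).1 hX
  | neq t u => exact (hG.or (h := gsat M (.neq t u) I) (fun _ => Iff.rfl) X).1 hX
  | @rvar i m ts =>
    obtain ⟨rfl, rfl⟩ : i = 0 ∧ m = n := by simpa [rvG] using hrv
    obtain ⟨Y, hXY, hincl, hand⟩ := (teamSat_exs_iff _ _ X).1 hX
    rw [teamSat_listAnd] at hand
    have hV : ∀ v ∈ {v | v ∈ List.ofFn fun j : Fin m => k + (j : ℕ)}, k ≤ v := by
      simp only [mem_ofPred_eq, List.mem_ofFn]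
      rintro _ ⟨j, rfl⟩
      omega
    intro s hs
    obtain ⟨t, ht, hst⟩ := hXY.1 s hs
    by_cases hgs : g s
    · exact Or.inl hgs
    have hgt : ¬ g t := by
      rwa [← hg s t (eqOn_of_compl_of_disjoint hst fun v hv hv' =>
        absurd (hV v hv) (by have := hv'.2; omega))]
    right
    obtain ⟨r, hr, htr⟩ := hincl t ht
    have hrI := hXY.forall_tuple_mem (Q := I m 0)
      (fun v hv hv' => by have := hV v hv; have := hv'.2; omega) hI r hr
    have hts : (fun j => (ts j).realize s) = fun j : Fin m => r (W + (j : ℕ)) := by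
      rw [realize_tuple_congr_of_eqOn (t := t) (eqOn_of_compl_of_disjoint hst fun v hv hv' => by
        have := hV v hv; have := hav v hv'; omega)]
      funext j
      have hor := (hG.or (h := fun s => s (k + (j : ℕ)) = (ts j).realize s)
        (fun _ => Iff.rfl) Y).1 (hand _ (List.mem_ofFn.2 ⟨j, rfl⟩)) t ht
      exact (hor.resolve_left hgt).symm.trans (htr j)
    change (fun j => (ts j).realize s) ∈ I m 0
    rwa [hts]
  | and φ ψ ih₁ ih₂ =>
    intro s hs
    have h₁ := ih₁ hφ.1 (subset_union_left.trans hrv) (fun v hv => hav v (Or.inl hv))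
      G k hk g hG hg X hI hX.1 s hs
    have h₂ := ih₂ hφ.2 (subset_union_right.trans hrv) (fun v hv => hav v (Or.inr hv))
      G k hk g hG hg X hI hX.2 s hs
    simp only [gsat]
    tauto
  | or φ ψ ih₁ ih₂ =>
    obtain ⟨Y, hXY, hY₁, hY₂⟩ := (teamSat_exs_iff _ _ X).1 hX
    have hV : ∀ v ∈ {v | v ∈ [k, k + 1]}, k ≤ v := by simp
    intro s hs
    obtain ⟨t, ht, hst⟩ := hXY.1 s hs
    have hIY := hXY.forall_tuple_mem (Q := I n 0)
      (fun v hv hv' => by have := hV v hv; have := hv'.2; omega) hI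
    have h₁ := ih₁ hφ.1 (subset_union_left.trans hrv) (fun v hv => hav v (Or.inl hv))
      _ (k + 2) (by omega) _ (hG.or (flat_neq_var k (k + 1)))
      (or_congr_of_eqOn_Ico hk hg (· ≠ ·)) Y hIY hY₁ t ht
    have h₂ := ih₂ hφ.2 (subset_union_right.trans hrv) (fun v hv => hav v (Or.inr hv))
      _ (k + 2) (by omega) _ (hG.or (flat_eq_var k (k + 1)))
      (or_congr_of_eqOn_Ico hk hg (· = ·)) Y hIY hY₂ t ht
    rw [hg s t (eqOn_of_compl_of_disjoint hst fun v hv hv' => by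
        have := hV v hv; have := hv'.2; omega),
      gsat_congr_of_eqOn (.or φ ψ) hφ I (t := t) (eqOn_of_compl_of_disjoint hst fun v hv hv' => by
        have := hV v hv; have := hav v (fvG_subset_avG _ hv'); omega)]
    simp only [gsat]
    tauto
  | ex v φ ih =>
    obtain ⟨Y, hXY, hY⟩ := (teamSat_exs_iff [v] _ X).1 hX
    have hvW : v < W := hav v (Or.inl rfl)
    intro s hs
    obtain ⟨t, ht, hst⟩ := hXY.1 s hs
    have hIY := hXY.forall_tuple_mem (Q := I n 0) (by simp; omega) hI
    have h := ih hφ hrv (fun v hv => hav v (Or.inr hv)) G k hk g hG hg Y hIY hY t ht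
    rw [hg s t (eqOn_of_compl_of_disjoint hst (by simp; omega))]
    refine h.imp_right fun h => ⟨t v, ?_⟩
    rwa [← eq_update_of_eqOn_compl (by simpa using hst)]
  | all v φ ih =>
    have hvW : v < W := hav v (Or.inl rfl)
    intro s hs
    by_cases hgs : g s
    · exact Or.inl hgs
    refine Or.inr fun m => ?_
    have hIY := (teamEqv_dupTeam X v).forall_tuple_mem (Q := I n 0) (by simp; omega) hI
    have h := ih hφ hrv (fun v hv => hav v (Or.inr hv)) G k hk g hG hg _ hIY hX _ ⟨s, hs, m, rfl⟩
    refine h.resolve_left ?_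
    rwa [← hg s _ (eqOn_of_compl_of_disjoint (eqOn_update_compl s v m) (by simp; omega))]
  | gfp => exact hφ.elim

theorem teamSat_guardTr_of_gsat [Nontrivial M] {n W : ℕ} (I : RelInterp M) (φ : GFPForm L)
    (hφ : NoGfp φ) (hrv : rvG φ ⊆ {(0, n)}) (hav : ∀ v ∈ avG φ, v < W) (G : IncForm L) (k : ℕ)
    (hk : W + n ≤ k) (g : (ℕ → M) → Prop) (hG : Flat M G g)
    (hg : ∀ s t, EqOn s t (Ico (W + n) k) → (g s ↔ g t)) (X : Set (ℕ → M))
    (hI : ∀ s ∈ X, ∀ a ∈ I n 0, ∃ s' ∈ X, (fun j : Fin n => s' (W + (j : ℕ))) = a)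
    (hX : ∀ s ∈ X, g s ∨ gsat M φ I s) : teamSat M (guardTr W φ G k) X := by
  induction φ generalizing G k g X with
  | rel R ts => exact (hG.or (h := gsat M (.rel R ts) I) (fun _ => Iff.rfl) X).2 hX
  | nrel R ts => exact (hG.or (h := gsat M (.nrel R ts) I) (fun _ => Iff.rfl) X).2 hX
  | eq t u => exact (hG.or (h := gsat M (.eq t u) I) (fun _ => Iff.rfl) X).2 hX
  | neq t u => exact (hG.or (h := gsat M (.neq t u) I) (fun _ => Iff.rfl) X).2 hX
  | @rvar i m ts =>
    obtain ⟨rfl, rfl⟩ : i = 0 ∧ m = n := by simpa [rvG] using hrv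
    have hV : ∀ v ∈ {v | v ∈ List.ofFn fun j : Fin m => k + (j : ℕ)}, k ≤ v := by
      simp only [mem_ofPred_eq, List.mem_ofFn]
      rintro _ ⟨j, rfl⟩
      omega
    refine teamSat_exs_of_forall_exists (fun t =>
      (∃ r ∈ X, ∀ j : Fin m, t (k + (j : ℕ)) = r (W + (j : ℕ))) ∧
        (g t ∨ ∀ j : Fin m, t (k + (j : ℕ)) = (ts j).realize t)) ?_ ?_
    · intro s hs
      have key : ∀ a : Fin m → M, ∃ t,
          EqOn s t {v | v ∈ List.ofFn fun j : Fin m => k + (j : ℕ)}ᶜ ∧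
            ∀ j : Fin m, t (k + (j : ℕ)) = a j := by
        intro a
        refine ⟨fun v => if h : k ≤ v ∧ v - k < m then a ⟨v - k, h.2⟩ else s v, ?_, ?_⟩
        · intro v hv
          have : ¬ (k ≤ v ∧ v - k < m) := fun h => hv
            (List.mem_ofFn.2 ⟨⟨v - k, h.2⟩, by simp only; omega⟩)
          simp [this]
        · intro j
          simp
      have hgt : ∀ t, EqOn s t {v | v ∈ List.ofFn fun j : Fin m => k + (j : ℕ)}ᶜ →
          (g s ↔ g t) := fun t hst => hg s t (eqOn_of_compl_of_disjoint hst fun v hv hv' => by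
        have := hV v hv; have := hv'.2; omega)
      rcases hX s hs with hgs | hR
      · obtain ⟨t, hst, ht⟩ := key fun j => s (W + (j : ℕ))
        exact ⟨t, hst, ⟨s, hs, ht⟩, Or.inl ((hgt t hst).1 hgs)⟩
      · obtain ⟨r, hr, hrs⟩ := hI s hs _ hR
        obtain ⟨t, hst, ht⟩ := key fun j => r (W + (j : ℕ))
        refine ⟨t, hst, ⟨r, hr, ht⟩, Or.inr fun j => ?_⟩
        rw [ht j, congrFun hrs j]
        exact congrFun (realize_tuple_congr_of_eqOn (t := t)
          (eqOn_of_compl_of_disjoint hst fun v hv hv' => by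
            have := hV v hv; have := hav v hv'; omega)) j
    · intro Y hXY _ hP
      refine ⟨fun t ht => ?_, (teamSat_listAnd _ _).2 fun χ hχ => ?_⟩
      · obtain ⟨⟨r, hr, htr⟩, -⟩ := hP t ht
        obtain ⟨r', hr', hrr'⟩ := hXY.1 r hr
        refine ⟨r', hr', fun j => (htr j).trans (hrr' fun hv => ?_)⟩
        have := hV _ hv
        omega
      · obtain ⟨j, rfl⟩ := List.mem_ofFn.1 hχ
        exact (hG.or (h := fun s => s (k + (j : ℕ)) = (ts j).realize s)
          (fun _ => Iff.rfl) Y).2 fun t ht => (hP t ht).2.imp_right fun h => h j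
  | and φ ψ ih₁ ih₂ =>
    exact ⟨ih₁ hφ.1 (subset_union_left.trans hrv) (fun v hv => hav v (Or.inl hv))
      G k hk g hG hg X hI fun s hs => (hX s hs).imp_right And.left,
      ih₂ hφ.2 (subset_union_right.trans hrv) (fun v hv => hav v (Or.inr hv))
      G k hk g hG hg X hI fun s hs => (hX s hs).imp_right And.right⟩
  | or φ ψ ih₁ ih₂ =>
    have hV : ∀ v ∈ {v | v ∈ [k, k + 1]}, k ≤ v := by simp
    refine teamSat_exs_of_forall_exists (fun t =>
      ((g t ∨ t k ≠ t (k + 1)) ∨ gsat M φ I t) ∧ ((g t ∨ t k = t (k + 1)) ∨ gsat M ψ I t)) ?_ ?_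
    · intro s hs
      obtain ⟨a, b, hab⟩ := exists_pair_ne M
      have key : ∀ c d : M, EqOn s (Function.update (Function.update s k c) (k + 1) d)
          {v | v ∈ [k, k + 1]}ᶜ := by
        intro c d v hv
        simp only [List.mem_cons, List.not_mem_nil, or_false, mem_compl_iff, mem_ofPred_eq,
          not_or] at hv
        simp [hv.1, hv.2]
      have hloc : ∀ c d : M,
          (g s ∨ gsat M (.or φ ψ) I s) ↔
            (g (Function.update (Function.update s k c) (k + 1) d) ∨
              gsat M (.or φ ψ) I (Function.update (Function.update s k c) (k + 1) d)) := by
        intro c d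
        rw [hg s _ (eqOn_of_compl_of_disjoint (key c d) fun v hv hv' => by
            have := hV v hv; have := hv'.2; omega),
          gsat_congr_of_eqOn (.or φ ψ) hφ I
            (eqOn_of_compl_of_disjoint (key c d) fun v hv hv' => by
              have := hV v hv; have := hav v (fvG_subset_avG _ hv'); omega)]
      by_cases h : g (Function.update (Function.update s k a) (k + 1) a) ∨
          gsat M φ I (Function.update (Function.update s k a) (k + 1) a)
      · refine ⟨_, key a a, ?_, ?_⟩
        · tauto
        · left; right; simp
      · refine ⟨_, key a b, ?_, ?_⟩
        · left; right; simpa using hab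
        · have hsub : ¬ (g s ∨ gsat M φ I s) := by
            rwa [hg s _ (eqOn_of_compl_of_disjoint (key a a) fun v hv hv' => by
                have := hV v hv; have := hv'.2; omega),
              gsat_congr_of_eqOn φ hφ.1 I
                (eqOn_of_compl_of_disjoint (key a a) fun v hv hv' => by
                  have := hV v hv; have := hav v (fvG_subset_avG _ (Or.inl hv')); omega)]
          have hψ : gsat M ψ I s := by
            have := hX s hs
            simp only [gsat] at this
            tauto
          right
          rwa [← gsat_congr_of_eqOn ψ hφ.2 I
            (eqOn_of_compl_of_disjoint (key a b) fun v hv hv' => by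
              have := hV v hv; have := hav v (fvG_subset_avG _ (Or.inr hv')); omega)]
    · intro Y hXY _ hP
      have hIY := hXY.forall_exists_tuple_eq (Q := I n 0)
        (fun v hv hv' => by have := hV v hv; have := hv'.2; omega) hI
      exact ⟨ih₁ hφ.1 (subset_union_left.trans hrv) (fun v hv => hav v (Or.inl hv))
          _ (k + 2) (by omega) _ (hG.or (flat_neq_var k (k + 1)))
          (or_congr_of_eqOn_Ico hk hg (· ≠ ·)) Y hIY fun t ht => (hP t ht).1,
        ih₂ hφ.2 (subset_union_right.trans hrv) (fun v hv => hav v (Or.inr hv))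
          _ (k + 2) (by omega) _ (hG.or (flat_eq_var k (k + 1)))
          (or_congr_of_eqOn_Ico hk hg (· = ·)) Y hIY fun t ht => (hP t ht).2⟩
  | ex v φ ih =>
    have hvW : v < W := hav v (Or.inl rfl)
    refine teamSat_exs_of_forall_exists (fun t => g t ∨ gsat M φ I t) ?_ ?_
    · intro s hs
      rcases hX s hs with h | ⟨m, h⟩
      · exact ⟨s, fun _ _ => rfl, Or.inl h⟩
      · exact ⟨_, by simpa using eqOn_update_compl s v m, Or.inr h⟩
    · intro Y hXY _ hP
      exact ih hφ hrv (fun v hv => hav v (Or.inr hv)) G k hk g hG hg Y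
        (hXY.forall_exists_tuple_eq (by simp; omega) hI) hP
  | all v φ ih =>
    have hvW : v < W := hav v (Or.inl rfl)
    refine ih hφ hrv (fun v hv => hav v (Or.inr hv)) G k hk g hG hg _
        ((teamEqv_dupTeam X v).forall_exists_tuple_eq (by simp; omega) hI) ?_
    rintro _ ⟨s, hs, m, rfl⟩
    rw [← hg s _ (eqOn_of_compl_of_disjoint (eqOn_update_compl s v m) (by simp; omega))]
    exact (hX s hs).imp_right fun h => h m
  | gfp => exact hφ.elim

end GuardedTranslation

section GreatestFixedPoint

variable {L : Language} {M : Type*} [L.Structure M]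

theorem updI_self (I : RelInterp M) (n i : ℕ) (Q : Set (Fin n → M)) : updI I n i Q n i = Q := by
  ext a
  simp [updI]

theorem updI_mono (I : RelInterp M) (n i : ℕ) {Q Q' : Set (Fin n → M)} (h : Q ⊆ Q') (k j : ℕ) :
    updI I n i Q k j ⊆ updI I n i Q' k j := by
  intro a ha
  simp only [updI, mem_ofPred_eq] at ha ⊢
  split_ifs at ha ⊢ with hkj
  · exact h ha
  · exact ha

theorem gsat_mono (φ : GFPForm L) (hφ : NoGfp φ) {I J : RelInterp M}
    (hIJ : ∀ k j, I k j ⊆ J k j) {s : ℕ → M} (h : gsat M φ I s) : gsat M φ J s := by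
  induction φ generalizing s with
  | rel | nrel | eq | neq => exact h
  | rvar i ts => exact hIJ _ _ h
  | and φ ψ ih₁ ih₂ => exact ⟨ih₁ hφ.1 h.1, ih₂ hφ.2 h.2⟩
  | or φ ψ ih₁ ih₂ => exact h.imp (ih₁ hφ.1) (ih₂ hφ.2)
  | ex v φ ih => exact h.imp fun m => ih hφ
  | all v φ ih => exact fun m => ih hφ (h m)
  | gfp => exact hφ.elim

theorem updVec_val (s : ℕ → M) {n : ℕ} (a : Fin n → M) (j : Fin n) :
    updVec s (fun j : Fin n => (j : ℕ)) a j = a j := by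
  have h : ∃ i : Fin n, (i : ℕ) = j := ⟨j, rfl⟩
  rw [updVec, dif_pos h]
  exact congrArg a (Fin.ext h.choose_spec)

/-- The part of the translation of `[gfp_{R,x̄} η] z̄` which deals with one-element structures. -/
def trivialGfpTr (n : ℕ) (η : GFPForm L) : IncForm L :=
  .and (.all 0 (.all 1 (.eq (Term.var 0) (Term.var 1)))) (exs (List.range n) (flatTr η))

theorem fvInc_trivialGfpTr {n : ℕ} {η : GFPForm L} (hfv : fvG η ⊆ {v : ℕ | v < n}) :
    fvInc (trivialGfpTr n η) = ∅ := by
  rw [trivialGfpTr, fvInc, fvInc_exs]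
  refine union_empty_iff.2 ⟨?_, ?_⟩
  · ext x
    simp only [fvInc, tvars, mem_sdiff, mem_union, mem_singleton_iff, mem_empty_iff_false]
    tauto
  · rw [sdiff_eq_empty]
    exact fun x hx => List.mem_range.2 (hfv (fvInc_flatTr η hx))

/-- The part of the translation of `[gfp_{R,x̄} η] z̄` which deals with structures having at least
two elements. The variables from `W` on hold a tuple of a post-fixed point. -/
def mainGfpTr (n W : ℕ) (η : GFPForm L) : IncForm L :=
  exs ((List.ofFn fun j : Fin n => W + (j : ℕ)) ++ List.range n)
    (.and (.incl (fun j : Fin n => Term.var (n + (j : ℕ))) fun j => Term.var (W + (j : ℕ)))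
      (.and (listAnd (List.ofFn fun j : Fin n => .eq (Term.var (j : ℕ)) (Term.var (W + (j : ℕ)))))
        (guardTr W η falsum (W + n))))

theorem fvInc_mainGfpTr {n W : ℕ} {η : GFPForm L} (hrv : rvG η ⊆ {(0, n)})
    (hfv : fvG η ⊆ {v : ℕ | v < n}) :
    fvInc (mainGfpTr n W η) ⊆ {v : ℕ | n ≤ v ∧ v < n + n} := by
  rw [mainGfpTr, fvInc_exs]
  rintro x ⟨hx, hx'⟩
  simp only [mem_ofPred_eq, List.mem_append, List.mem_ofFn, List.mem_range, not_or,
    not_exists] at hx'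
  have hxW : x ∉ Ico W (W + n) := fun h => hx'.1 ⟨x - W, by have := h.1; have := h.2; omega⟩ (by
    have := h.1
    simp only
    omega)
  simp only [fvInc, fvInc_listAnd, tvars, mem_union, mem_iUnion, mem_singleton_iff,
    List.mem_ofFn, exists_prop] at hx
  rcases hx with (⟨j, rfl⟩ | ⟨j, rfl⟩) | ⟨_, ⟨j, rfl⟩, hj⟩ | hx
  · exact ⟨by omega, by omega⟩
  · exact (hx'.1 j rfl).elim
  · simp only [fvInc, tvars, mem_union, mem_singleton_iff] at hj
    rcases hj with rfl | rfl
    · exact (hx'.2 j.isLt).elim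
    · exact (hx'.1 j rfl).elim
  · rcases fvInc_guardTr W η hrv _ _ hx with (hx | hx) | hx
    · exact (hx'.2 (hfv hx)).elim
    · simp [fvInc_falsum] at hx
    · exact (hxW hx).elim

/-- The formula `[gfp_{R,x̄} η] z̄`, with `x̄` the variables below `n` and `z̄` the next `n` ones. -/
abbrev gfpForm (n : ℕ) (η : GFPForm L) : GFPForm L :=
  .gfp 0 n (fun j : Fin n => (j : ℕ)) η fun j : Fin n => Term.var (n + (j : ℕ))

theorem gsat_gfpForm_iff (n : ℕ) (η : GFPForm L) (I : RelInterp M) (s : ℕ → M) :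
    gsat M (gfpForm n η) I s ↔ ∃ Q : Set (Fin n → M),
      (∀ a ∈ Q, gsat M η (updI I n 0 Q) (updVec s (fun j : Fin n => (j : ℕ)) a)) ∧
        (fun j : Fin n => s (n + (j : ℕ))) ∈ Q :=
  Iff.rfl

theorem gsat_updVec_congr {n : ℕ} {η : GFPForm L} (hfo : NoGfp η)
    (hfv : fvG η ⊆ {v : ℕ | v < n}) (I : RelInterp M) {s t : ℕ → M} {a : Fin n → M}
    (ht : ∀ j : Fin n, t j = a j) :
    gsat M η I (updVec s (fun j : Fin n => (j : ℕ)) a) ↔ gsat M η I t :=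
  gsat_congr_of_eqOn η hfo I fun v hv =>
    (updVec_val s a ⟨v, hfv hv⟩).trans (ht ⟨v, hfv hv⟩).symm

theorem gsat_gfpForm_of_teamSat_trivialGfpTr {n : ℕ} {η : GFPForm L} (hfo : NoGfp η)
    (hrv : rvG η ⊆ {(0, n)}) {X : Set (ℕ → M)} (hX : teamSat M (trivialGfpTr n η) X) :
    ∀ s ∈ X, gsat M (gfpForm n η) (botI M) s := by
  intro s hs
  have hM := (((flat_eq_var 0 1).all 1).all 0 X).1 hX.1 s hs
  have : Subsingleton M := ⟨fun a b => by simpa using hM a b⟩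
  obtain ⟨Y, hXY, hY⟩ := (teamSat_exs_iff _ _ X).1 hX.2
  obtain ⟨t, ht, -⟩ := hXY.1 s hs
  refine (gsat_gfpForm_iff n η _ s).2 ⟨univ, fun a _ => ?_, mem_univ _⟩
  rw [Subsingleton.elim (updVec s (fun j : Fin n => (j : ℕ)) a) t]
  refine (flat_flatTr η hfo _ fun p hp => ?_) Y |>.1 hY t ht
  obtain rfl := hrv hp
  exact updI_self _ _ _ _

theorem teamSat_trivialGfpTr_of_gsat [Subsingleton M] {n : ℕ} {η : GFPForm L} (hfo : NoGfp η)
    (hrv : rvG η ⊆ {(0, n)}) {X : Set (ℕ → M)}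
    (hX : ∀ s ∈ X, gsat M (gfpForm n η) (botI M) s) : teamSat M (trivialGfpTr n η) X := by
  refine ⟨(((flat_eq_var 0 1).all 1).all 0 X).2 fun s _ a b => Subsingleton.elim _ _,
    (teamSat_exs_iff _ _ X).2 ⟨X, ⟨fun s hs => ⟨s, hs, fun _ _ => rfl⟩,
      fun s hs => ⟨s, hs, fun _ _ => rfl⟩⟩, ?_⟩⟩
  refine (flat_flatTr η hfo (updI (botI M) n 0 univ) fun p hp => ?_) X |>.2 fun s hs => ?_
  · obtain rfl := hrv hp
    exact updI_self _ _ _ _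
  · obtain ⟨Q, hQ, hsQ⟩ := (gsat_gfpForm_iff n η _ s).1 (hX s hs)
    have h := hQ _ hsQ
    have hQ_univ : Q = univ := Q.eq_univ_of_forall fun a => by rwa [Subsingleton.elim a]
    rw [hQ_univ] at h
    convert h using 1

theorem gsat_gfpForm_of_teamSat_mainGfpTr {n W : ℕ} {η : GFPForm L} (hfo : NoGfp η)
    (hrv : rvG η ⊆ {(0, n)}) (hfv : fvG η ⊆ {v : ℕ | v < n}) (hav : ∀ v ∈ avG η, v < W)
    (hW : n + n ≤ W) {X : Set (ℕ → M)} (hX : teamSat M (mainGfpTr n W η) X) :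
    ∀ s ∈ X, gsat M (gfpForm n η) (botI M) s := by
  obtain ⟨Y, hXY, hincl, heq, hη⟩ := (teamSat_exs_iff _ _ X).1 hX
  rw [teamSat_listAnd] at heq
  intro s hs
  obtain ⟨t, ht, hst⟩ := hXY.1 s hs
  refine (gsat_gfpForm_iff n η _ s).2
    ⟨{a | ∃ t ∈ Y, (fun j : Fin n => t (W + (j : ℕ))) = a}, ?_, ?_⟩
  · rintro _ ⟨r, hr, rfl⟩
    have hr_eq : ∀ j : Fin n, r j = r (W + (j : ℕ)) :=
      fun j => heq _ (List.mem_ofFn.2 ⟨j, rfl⟩) r hr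
    refine (gsat_updVec_congr hfo hfv _ hr_eq).2 ?_
    refine (gsat_of_teamSat_guardTr _ η hfo hrv hav falsum (W + n) le_rfl _ flat_falsum
      (fun _ _ _ => Iff.rfl) Y (fun q hq => ?_) hη r hr).resolve_left id
    rw [updI_self]
    exact ⟨q, hq, rfl⟩
  · obtain ⟨r, hr, htr⟩ := hincl t ht
    refine ⟨r, hr, funext fun j => (htr j).symm.trans (hst ?_).symm⟩
    simp only [mem_compl_iff, mem_ofPred_eq, List.mem_append, List.mem_ofFn, List.mem_range,
      not_or, not_exists]
    exact ⟨fun i => by omega, by omega⟩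

theorem teamSat_mainGfpTr_of_gsat [Nontrivial M] {n W : ℕ} {η : GFPForm L} (hfo : NoGfp η)
    (hrv : rvG η ⊆ {(0, n)}) (hfv : fvG η ⊆ {v : ℕ | v < n}) (hav : ∀ v ∈ avG η, v < W)
    (hW : n + n ≤ W) {X : Set (ℕ → M)} (hX : ∀ s ∈ X, gsat M (gfpForm n η) (botI M) s) :
    teamSat M (mainGfpTr n W η) X := by
  obtain ⟨Q, hQ, hXQ⟩ : ∃ Q : Set (Fin n → M),
      (∀ a ∈ Q, ∀ t : ℕ → M, (∀ j : Fin n, t j = a j) → gsat M η (updI (botI M) n 0 Q) t) ∧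
        ∀ s ∈ X, (fun j : Fin n => s (n + (j : ℕ))) ∈ Q := by
    refine ⟨⋃₀ {Q | ∀ a ∈ Q, ∀ t : ℕ → M, (∀ j : Fin n, t j = a j) →
      gsat M η (updI (botI M) n 0 Q) t}, ?_, fun s hs => ?_⟩
    · rintro a ⟨Q, hQ, ha⟩ t ht
      exact gsat_mono η hfo (updI_mono _ _ _ (subset_sUnion_of_mem hQ)) (hQ a ha t ht)
    · obtain ⟨Q, hQ, hsQ⟩ := (gsat_gfpForm_iff n η _ s).1 (hX s hs)
      exact ⟨Q, fun a ha t ht => (gsat_updVec_congr hfo hfv _ ht).1 (hQ a ha), hsQ⟩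
  have key : ∀ (s : ℕ → M) (a : Fin n → M), ∃ t, EqOn s t
      {v | v ∈ (List.ofFn fun j : Fin n => W + (j : ℕ)) ++ List.range n}ᶜ ∧
      (fun j : Fin n => t (W + (j : ℕ))) = a ∧ ∀ j : Fin n, t j = t (W + (j : ℕ)) := by
    intro s a
    refine ⟨fun v => if h : v < n then a ⟨v, h⟩ else
      if h : W ≤ v ∧ v - W < n then a ⟨v - W, h.2⟩ else s v, ?_, ?_, ?_⟩
    · intro v hv
      simp only [mem_compl_iff, mem_ofPred_eq, List.mem_append, List.mem_ofFn, List.mem_range,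
        not_or, not_exists] at hv
      have : ¬ (W ≤ v ∧ v - W < n) := fun h => hv.1 ⟨v - W, h.2⟩ (by simp only; omega)
      simp [hv.2, this]
    · funext j
      have : ¬ W + (j : ℕ) < n := by omega
      simp [this]
    · intro j
      have : ¬ W + (j : ℕ) < n := by omega
      simp [this]
  refine teamSat_exs_of_forall_exists (fun t => (fun j : Fin n => t (W + (j : ℕ))) ∈ Q ∧
    ∀ j : Fin n, t j = t (W + (j : ℕ))) (fun s hs => ?_) fun Y hXY hY hP => ?_
  · obtain ⟨t, hst, hta, ht⟩ := key s _
    exact ⟨t, hst, hta ▸ hXQ s hs, ht⟩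
  have hYQ : ∀ t ∈ Y, ∀ a ∈ Q, ∃ t' ∈ Y, (fun j : Fin n => t' (W + (j : ℕ))) = a := by
    intro t ht a ha
    obtain ⟨s, hs, -⟩ := hXY.2 t ht
    obtain ⟨t', hst', rfl, ht'⟩ := key s a
    exact ⟨t', hY s hs t' hst' ⟨ha, ht'⟩, rfl⟩
  refine ⟨fun t ht => ?_, (teamSat_listAnd _ _).2 fun χ hχ => ?_, ?_⟩
  · obtain ⟨s, hs, hst⟩ := hXY.2 t ht
    obtain ⟨t', ht', h⟩ := hYQ t ht _ (hXQ s hs)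
    refine ⟨t', ht', fun j => (hst ?_).symm.trans (congrFun h j).symm⟩
    simp only [mem_compl_iff, mem_ofPred_eq, List.mem_append, List.mem_ofFn, List.mem_range,
      not_or, not_exists]
    exact ⟨fun i => by omega, by omega⟩
  · obtain ⟨j, rfl⟩ := List.mem_ofFn.1 hχ
    exact fun t ht => (hP t ht).2 j
  · refine teamSat_guardTr_of_gsat (updI (botI M) n 0 Q) η hfo hrv hav falsum (W + n) le_rfl _
      flat_falsum (fun _ _ _ => Iff.rfl) Y ?_ fun t ht => Or.inr ?_
    · rwa [updI_self]
    · exact hQ _ (hP t ht).1 t (hP t ht).2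

end GreatestFixedPoint

end TeamSem

open TeamSem in
/-- Theorem `gfp-inc`, part (b): let `η(R, x̄)` be a first-order formula
(no `gfp` operators) in which `R` occurs only positively (here `R` is relation variable
number `0` of arity `n`; relation variables occur only positively in `GFPForm`), with
free variables among `x̄ = (x₁,…,xₙ)` (here the variables `0,…,n-1`), and let `z̄` be an
`n`-tuple of variables not occurring in `η` (here the variables `n,…,2n-1`). Then there
is an inclusion logic formula `η̃(z̄)` such that for all structures `M` and teams `X`:
`M ⊨_X η̃(z̄)` iff `M ⊨_s [gfp_{R,x̄} η(R,x̄)] z̄` for every `s ∈ X`. -/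
theorem gfp_to_inc_b {L : Language} (n : ℕ) (η : GFPForm L) (hfo : NoGfp η)
    (hrv : rvG η ⊆ {(0, n)}) (hfv : fvG η ⊆ {v : ℕ | v < n})
    (hz : ∀ j : Fin n, (n + (j : ℕ)) ∉ avG η) :
    ∃ ηtilde : IncForm L, fvInc ηtilde ⊆ {v : ℕ | n ≤ v ∧ v < n + n} ∧
      ∀ (M : Type*) [L.Structure M] (X : Set (ℕ → M)),
        teamSat M ηtilde X ↔ ∀ s ∈ X,
          gsat M (GFPForm.gfp 0 n (fun j : Fin n => (j : ℕ)) η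
              (fun j : Fin n => Term.var (n + (j : ℕ))))
            (botI M) s := by
  obtain ⟨b, hb⟩ := (finite_avG η).bddAbove
  obtain ⟨W, hW, hav⟩ : ∃ W, n + n ≤ W ∧ ∀ v ∈ avG η, v < W :=
    ⟨n + n + b + 1, by omega, fun v hv => by have := hb hv; omega⟩
  refine ⟨.or (trivialGfpTr n η) (mainGfpTr n W η), ?_, fun M _ X => ⟨?_, fun hX => ?_⟩⟩
  · rw [fvInc, fvInc_trivialGfpTr hfv, empty_union]
    exact fvInc_mainGfpTr hrv hfv
  · rintro ⟨Y, Z, rfl, hY, hZ⟩ s (hs | hs)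
    · exact gsat_gfpForm_of_teamSat_trivialGfpTr hfo hrv hY s hs
    · exact gsat_gfpForm_of_teamSat_mainGfpTr hfo hrv hfv hav hW hZ s hs
  · rcases subsingleton_or_nontrivial M with hM | hM
    · exact ⟨X, ∅, (union_empty X).symm, teamSat_trivialGfpTr_of_gsat hfo hrv hX, teamSat_empty _⟩
    · exact ⟨∅, X, (empty_union X).symm, teamSat_empty _,
        teamSat_mainGfpTr_of_gsat hfo hrv hfv hav hW hX⟩
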